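/- Let X be a length space and let g be an isometry of X with translation length [g] = inf_{x∈X} d(gx,x). For every l > 0 there exist a real number T with [g] ≤ T < [g] + l and a T-local (1,l)-quasi-geodesic γ : ℝ → X such that γ(t + T) = g·γ(t) for every t ∈ ℝ. -/

import Mathlib

/-- A length space: any two points are joined by a rectifiable path (here
parametrized by arclength, hence `1`-Lipschitz) of length at most `d(x,y) + ε`. -/
def IsLengthSpace (X : Type*) [MetricSpace X] : Prop :=
  ∀ x y : X, ∀ ε : ℝ, 0 < ε → ∃ L : ℝ, 0 ≤ L ∧ L ≤ dist x y + ε ∧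
    ∃ γ : ℝ → X, γ 0 = x ∧ γ L = y ∧ LipschitzOnWith 1 γ (Set.Icc 0 L)

/-- The translation length of a self-map `g` of `X`. -/
noncomputable def translationLength {X : Type*} [MetricSpace X] (g : X → X) : ℝ :=
  ⨅ x : X, dist (g x) x

/-- `γ`, parametrized by arclength, is a `T`-local `(1,l)`-quasi-geodesic on the
set `s`: it is `1`-Lipschitz there, and `|t - t'| ≤ d(γ t, γ t') + l` whenever
`|t - t'| ≤ T`. -/
def LocalQuasiGeodesicOn {X : Type*} [MetricSpace X] (γ : ℝ → X) (s : Set ℝ)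
    (T l : ℝ) : Prop :=
  (∀ t ∈ s, ∀ t' ∈ s, dist (γ t) (γ t') ≤ |t - t'|) ∧
  (∀ t ∈ s, ∀ t' ∈ s, |t - t'| ≤ T → |t - t'| ≤ dist (γ t) (γ t') + l)

/-- A path that is `1`-Lipschitz on a fundamental domain `[0, T]` and equivariant under an
isometry is `1`-Lipschitz on the whole line. -/
theorem dist_le_abs_sub_of_equivariant {X : Type*} [MetricSpace X] {g : X → X} (hg : Isometry g)
    {γ : ℝ → X} {T : ℝ} (hT : 0 < T) (hγ : ∀ t, γ (t + T) = g (γ t))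
    (hbase : ∀ s t, 0 ≤ s → s ≤ t → t ≤ T → dist (γ s) (γ t) ≤ t - s) (s t : ℝ) :
    dist (γ s) (γ t) ≤ |s - t| := by
  have shift : ∀ s t, dist (γ (s + T)) (γ (t + T)) = dist (γ s) (γ t) := fun s t => by
    rw [hγ, hγ, hg.dist_eq]
  have hpos : ∀ n : ℕ, ∀ s t, 0 ≤ s → s ≤ t → t ≤ n * T → dist (γ s) (γ t) ≤ t - s := by
    intro n
    induction n with
    | zero =>
      intro s t hs hst ht
      norm_num at ht
      exact hbase s t hs hst (by linarith)
    | succ n ih =>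
      intro s t hs hst ht
      push_cast at ht
      have later : ∀ s, T ≤ s → s ≤ t → dist (γ s) (γ t) ≤ t - s := by
        intro s hs hst
        have h := ih (s - T) (t - T) (by linarith) (by linarith) (by linarith)
        rw [← shift, sub_add_cancel, sub_add_cancel] at h
        linarith
      rcases le_total t T with htT | htT
      · exact hbase s t hs hst htT
      rcases le_total T s with hsT | hsT
      · exact later s hsT hst
      · have h₁ := hbase s T hs hsT le_rfl
        have h₂ := later T le_rfl htT
        linarith [dist_triangle (γ s) (γ T) (γ t)]
  have shift_nat : ∀ (k : ℕ) s t, dist (γ (s + k * T)) (γ (t + k * T)) = dist (γ s) (γ t) := by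
    intro k
    induction k with
    | zero => simp
    | succ k ih =>
      intro s t
      rw [← ih s t, ← shift (s + k * T)]
      push_cast
      ring_nf
  have hle : ∀ s t, s ≤ t → dist (γ s) (γ t) ≤ t - s := by
    intro s t hst
    obtain ⟨k, hk⟩ := exists_nat_ge (-s / T)
    rw [div_le_iff₀ hT] at hk
    obtain ⟨n, hn⟩ := exists_nat_ge ((t + k * T) / T)
    rw [div_le_iff₀ hT] at hn
    have h := hpos n (s + k * T) (t + k * T) (by linarith) (by linarith) hn
    rw [shift_nat] at h
    linarith
  rcases le_total s t with hst | hst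
  · rw [abs_of_nonpos (by linarith)]
    linarith [hle s t hst]
  · rw [abs_of_nonneg (by linarith), dist_comm]
    exact hle t s hst

/-- A `1`-Lipschitz path from `x` to `g x` extends to a `g`-equivariant `1`-Lipschitz line. -/
theorem exists_equivariant_line {X : Type*} [MetricSpace X] {g : X → X} (hg : Isometry g)
    (hgs : Function.Surjective g) {T : ℝ} (hT : 0 < T) {c : ℝ → X} (hc : c T = g (c 0))
    (hlip : LipschitzOnWith 1 c (Set.Icc 0 T)) :
    ∃ γ : ℝ → X, (∀ s t, dist (γ s) (γ t) ≤ |s - t|) ∧ ∀ t, γ (t + T) = g (γ t) := by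
  let e : X ≃ᵢ X := ⟨Equiv.ofBijective g ⟨hg.injective, hgs⟩, hg⟩
  have he : ∀ x, e x = g x := fun _ => rfl
  let γ : ℝ → X := fun t => (e ^ ⌊t / T⌋) (c (Int.fract (t / T) * T))
  have hγ : ∀ t, γ (t + T) = g (γ t) := by
    intro t
    have hdiv : (t + T) / T = t / T + 1 := by field_simp
    simp only [γ, hdiv, Int.floor_add_one, Int.fract_add_one]
    rw [add_comm, zpow_add, zpow_one, IsometryEquiv.mul_apply, he]
  have hγc : ∀ t, 0 ≤ t → t ≤ T → γ t = c t := by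
    intro t h0 h1
    rcases h1.lt_or_eq with h1 | rfl
    · have hmem : 0 ≤ t / T ∧ t / T < 1 := ⟨by positivity, (div_lt_one hT).2 h1⟩
      have hfloor : ⌊t / T⌋ = 0 := Int.floor_eq_zero_iff.2 hmem
      have hfract : Int.fract (t / T) = t / T := Int.fract_eq_self.2 hmem
      simp only [γ, hfloor, hfract, zpow_zero, div_mul_cancel₀ t hT.ne']
      rfl
    · simp [γ, div_self hT.ne', he, hc]
  refine ⟨γ, dist_le_abs_sub_of_equivariant hg hT hγ fun s t hs hst ht => ?_, hγ⟩
  rw [hγc s hs (hst.trans ht), hγc t (hs.trans hst) ht]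
  have h := hlip.dist_le_mul s ⟨hs, hst.trans ht⟩ t ⟨hs.trans hst, ht⟩
  rwa [NNReal.coe_one, one_mul, dist_comm s t, Real.dist_eq,
    abs_of_nonneg (sub_nonneg.2 hst)] at h

theorem translationLength_le {X : Type*} [MetricSpace X] (g : X → X) (x : X) :
    translationLength g ≤ dist (g x) x :=
  ciInf_le ⟨0, Set.forall_mem_range.2 fun _ => dist_nonneg⟩ x

/-- An equivariant `1`-Lipschitz line whose period `T` is at most `l` above the translation
length is a `T`-local `(1,l)`-quasi-geodesic. -/
theorem localQuasiGeodesicOn_of_equivariant {X : Type*} [MetricSpace X] {g : X → X}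
    {γ : ℝ → X} {T l : ℝ} (hlip : ∀ s t, dist (γ s) (γ t) ≤ |s - t|)
    (hγ : ∀ t, γ (t + T) = g (γ t)) (hT : T ≤ translationLength g + l) :
    LocalQuasiGeodesicOn γ Set.univ T l := by
  have hle : ∀ s t, s ≤ t → t - s ≤ T → t - s ≤ dist (γ s) (γ t) + l := by
    intro s t hst h
    have h₁ := translationLength_le g (γ s)
    rw [← hγ, dist_comm] at h₁
    have h₂ := hlip t (s + T)
    rw [abs_of_nonpos (by linarith)] at h₂
    linarith [dist_triangle (γ s) (γ t) (γ (s + T))]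
  refine ⟨fun s _ t _ => hlip s t, fun s _ t _ h => ?_⟩
  rcases le_total s t with hst | hst
  · rw [abs_of_nonpos (by linarith), neg_sub] at h ⊢
    exact hle s t hst h
  · rw [abs_of_nonneg (by linarith)] at h ⊢
    rw [dist_comm]
    exact hle t s hst h

theorem exists_nerve {X : Type*} [MetricSpace X] [Nonempty X]
    (hlen : IsLengthSpace X)
    (g : X → X) (hg : Isometry g) (hgs : Function.Surjective g)
    (l : ℝ) (hl : 0 < l) :
    ∃ T : ℝ, translationLength g ≤ T ∧ T < translationLength g + l ∧
      ∃ γ : ℝ → X, LocalQuasiGeodesicOn γ Set.univ T l ∧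
        ∀ t : ℝ, γ (t + T) = g (γ t) := by
  obtain ⟨x, hx⟩ : ∃ x, dist (g x) x < translationLength g + l / 2 :=
    exists_lt_of_ciInf_lt (lt_add_of_pos_right _ (half_pos hl))
  obtain ⟨T, hT0, hTle, c, hc0, hcT, hlip⟩ := hlen x (g x) (l / 2) (half_pos hl)
  rw [dist_comm] at hTle
  have hTlt : T < translationLength g + l := by linarith
  have hdist : dist (g x) x ≤ T := by
    have h := hlip.dist_le_mul T ⟨hT0, le_rfl⟩ 0 ⟨le_rfl, hT0⟩
    rwa [hc0, hcT, NNReal.coe_one, one_mul, Real.dist_eq, sub_zero, abs_of_nonneg hT0] at h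
  obtain ⟨γ, hγlip, hγ⟩ : ∃ γ : ℝ → X, (∀ s t, dist (γ s) (γ t) ≤ |s - t|) ∧
      ∀ t, γ (t + T) = g (γ t) := by
    rcases hT0.eq_or_lt with rfl | hTpos
    · exact ⟨fun _ => x, by simp, fun _ => (dist_le_zero.1 hdist).symm⟩
    · exact exists_equivariant_line hg hgs hTpos (by rw [hcT, hc0]) hlip
  exact ⟨T, (translationLength_le g x).trans hdist, hTlt, γ,
    localQuasiGeodesicOn_of_equivariant hγlip hγ hTlt.le, hγ⟩
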